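/- Define the Airy function Ai : ℝ → ℝ by Ai(a) = (1/π) · lim_{R→∞} ∫₀^R cos(s³/3 + a s) ds. Fix λ ∈ (0,1), set χ = λ(1−λ), and fix real numbers ξ, u, v. For t > 0 define n(t) = ⌊λ² t + λ 2^{5/3} χ^{1/3} ξ t^{2/3}⌋, x(t) = ⌊(1−2λ) t − 2^{5/3} χ^{1/3} ξ t^{2/3} − 2^{1/3} χ^{2/3} (u/λ) t^{1/3}⌋, y(t) = ⌊2^{1/3} χ^{2/3} (v/λ) t^{1/3}⌋, and for any fixed radius r ∈ (0,1) set S(t) = (1−λ)^{n(t)+x(t)−y(t)} · λ^{−n(t)} · (1/(2πi)) ∮_{|w|=r} (1−w)^{n(t)} e^{t(w−1+λ)} w^{−(n(t)+1+x(t)−y(t))} dw (for all sufficiently large t one has n(t) ≥ 0 and n(t)+1+x(t)−y(t) ≥ 1, so the integrand is meromorphic with its only pole at w = 0 and the integral is independent of r). Then lim_{t→∞} (2^{1/3} χ^{2/3} t^{1/3} / λ) · S(t) = 2^{1/3} · Ai( 2^{4/3} ξ² + 2^{1/3}(u+v) ) · e^{ −(8/3) ξ³ − 2 ξ (u+v)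 }. -/

import Mathlib

open Filter intervalIntegral

/-- The Airy function, `Ai(a) = (1/π) lim_{R→∞} ∫₀^R cos(s³/3 + a s) ds`. -/
noncomputable def Ai (a : ℝ) : ℝ :=
  (1 / Real.pi) *
    limUnder atTop (fun R : ℝ => ∫ s in (0:ℝ)..R, Real.cos (s ^ 3 / 3 + a * s))

/-- The KPZ-scaled particle index `n(t) = ⌊λ² t + λ 2^{5/3} χ^{1/3} ξ t^{2/3}⌋`,
with `χ = λ(1−λ)` (scaling (A.6) of the paper). -/
noncomputable def nIdx (lam ξ : ℝ) (t : ℝ) : ℤ :=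
  ⌊lam ^ 2 * t + lam * 2 ^ ((5:ℝ)/3) * (lam * (1 - lam)) ^ ((1:ℝ)/3) * ξ * t ^ ((2:ℝ)/3)⌋

/-- The KPZ-scaled space point
`x(t) = ⌊(1−2λ) t − 2^{5/3} χ^{1/3} ξ t^{2/3} − 2^{1/3} χ^{2/3} (u/λ) t^{1/3}⌋`. -/
noncomputable def xIdx (lam ξ u : ℝ) (t : ℝ) : ℤ :=
  ⌊(1 - 2 * lam) * t - 2 ^ ((5:ℝ)/3) * (lam * (1 - lam)) ^ ((1:ℝ)/3) * ξ * t ^ ((2:ℝ)/3)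
    - 2 ^ ((1:ℝ)/3) * (lam * (1 - lam)) ^ ((2:ℝ)/3) * (u / lam) * t ^ ((1:ℝ)/3)⌋

/-- The KPZ-scaled point `y(t) = ⌊2^{1/3} χ^{2/3} (v/λ) t^{1/3}⌋`. -/
noncomputable def yIdx (lam v : ℝ) (t : ℝ) : ℤ :=
  ⌊2 ^ ((1:ℝ)/3) * (lam * (1 - lam)) ^ ((2:ℝ)/3) * (v / lam) * t ^ ((1:ℝ)/3)⌋

/-- The conjugated kernel entry `S_{−t,−n}(y, x)` of (A.7) of the paper:
`S(t) = (1−λ)^{n+x−y} λ^{−n} (2πi)⁻¹ ∮_{|w|=r} (1−w)^n e^{t(w−1+λ)} w^{−(n+1+x−y)} dw`,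
under the KPZ scaling (A.6). -/
noncomputable def Skernel (lam ξ u v r : ℝ) (t : ℝ) : ℂ :=
  ((1 : ℂ) - (lam : ℂ)) ^ (nIdx lam ξ t + xIdx lam ξ u t - yIdx lam v t)
    * (lam : ℂ) ^ (-(nIdx lam ξ t))
    * ((2 * (Real.pi : ℂ) * Complex.I)⁻¹
        * ∮ w in C(0, r),
            (1 - w) ^ (nIdx lam ξ t) * Complex.exp ((t : ℂ) * (w - 1 + (lam : ℂ)))
              * w ^ (-(nIdx lam ξ t + 1 + xIdx lam ξ u t - yIdx lam v t)))


theorem Complex.exists_log_one_add_eq :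
    ∃ E : ℂ → ℂ, Tendsto E (nhds 0) (nhds (1 / 3)) ∧
      ∀ y, Complex.log (1 + y) = y - y ^ 2 / 2 + y ^ 3 * E y := by
  refine ⟨fun y => if y = 0 then 1 / 3 else (Complex.log (1 + y) - y + y ^ 2 / 2) / y ^ 3, ?_, ?_⟩
  · rw [tendsto_iff_norm_sub_tendsto_zero]
    refine squeeze_zero' (g := fun y : ℂ => ‖y‖) (Eventually.of_forall fun _ => norm_nonneg _) ?_
      (by simpa using (continuous_norm (E := ℂ)).tendsto 0)
    filter_upwards [Metric.ball_mem_nhds (0 : ℂ) (ε := 1 / 2) (by norm_num)] with y hy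
    rw [mem_ball_zero_iff] at hy
    by_cases h : y = 0
    · simp [h]
    have hb := Complex.norm_log_sub_logTaylor_le 3 (z := y) (by linarith)
    have ht : Complex.logTaylor 4 y = y - y ^ 2 / 2 + y ^ 3 / 3 := by
      simp [Complex.logTaylor, Finset.sum_range_succ]
      ring
    rw [ht] at hb
    have e : (Complex.log (1 + y) - y + y ^ 2 / 2) / y ^ 3 - 1 / 3
        = (Complex.log (1 + y) - (y - y ^ 2 / 2 + y ^ 3 / 3)) / y ^ 3 := by
      field_simp
      ring
    have hy0 : 0 < ‖y‖ := norm_pos_iff.2 h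
    simp only [h, if_false]
    rw [e, norm_div, norm_pow, div_le_iff₀ (by positivity)]
    have hi : (1 - ‖y‖)⁻¹ ≤ 2 := by
      rw [inv_le_comm₀ (by linarith) (by norm_num)]
      linarith
    refine hb.trans ?_
    norm_num
    have : 0 ≤ ‖y‖ ^ 4 := by positivity
    nlinarith
  · intro y
    by_cases h : y = 0
    · simp [h]
    · simp only [h, if_false]
      field_simp
      ring

theorem Complex.exists_exp_eq :
    ∃ D : ℂ → ℂ, Tendsto D (nhds 0) (nhds (1 / 6)) ∧
      ∀ y, Complex.exp y = 1 + y + y ^ 2 / 2 + y ^ 3 * D y := by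
  refine ⟨fun y => if y = 0 then 1 / 6 else (Complex.exp y - 1 - y - y ^ 2 / 2) / y ^ 3, ?_, ?_⟩
  · rw [tendsto_iff_norm_sub_tendsto_zero]
    refine squeeze_zero' (g := fun y : ℂ => ‖y‖) (Eventually.of_forall fun _ => norm_nonneg _) ?_
      (by simpa using (continuous_norm (E := ℂ)).tendsto 0)
    filter_upwards [Metric.ball_mem_nhds (0 : ℂ) (ε := 1) (by norm_num)] with y hy
    rw [mem_ball_zero_iff] at hy
    by_cases h : y = 0
    · simp [h]
    have hb := Complex.exp_bound (x := y) hy.le (n := 4) (by norm_num)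
    have ht : ∑ m ∈ Finset.range 4, y ^ m / (m.factorial : ℂ)
        = 1 + y + y ^ 2 / 2 + y ^ 3 / 6 := by
      simp [Finset.sum_range_succ, Nat.factorial]
    rw [ht] at hb
    have e : (Complex.exp y - 1 - y - y ^ 2 / 2) / y ^ 3 - 1 / 6
        = (Complex.exp y - (1 + y + y ^ 2 / 2 + y ^ 3 / 6)) / y ^ 3 := by
      field_simp
      ring
    have hy0 : 0 < ‖y‖ := norm_pos_iff.2 h
    simp only [h, if_false]
    rw [e, norm_div, norm_pow, div_le_iff₀ (by positivity)]
    refine hb.trans ?_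
    have : 0 ≤ ‖y‖ ^ 4 := by positivity
    norm_num [Nat.factorial]
    nlinarith
  · intro y
    by_cases h : y = 0
    · simp [h]
    · simp only [h, if_false]
      field_simp
      ring

/-- The kernel integrand over its critical value, at `w = p * exp (z / T)` and time
`(l / p ^ 2) * T ^ 3`. -/
noncomputable def scaledIntegrand (p l : ℝ) (n m : ℤ) (T : ℝ) (z : ℂ) : ℂ :=
  Complex.exp (-m * (z / T) + (l / p * T ^ 3 : ℝ) * (Complex.exp (z / T) - 1))
    * ((1 - p * Complex.exp (z / T)) / l) ^ n

theorem tendsto_scaledIntegrand {p l c d C : ℝ} (hp : 0 < p) (hl : 0 < l) (hpl : p + l = 1)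
    {n m : ℝ → ℤ}
    (hn : ∀ᶠ T : ℝ in atTop, |n T - (l ^ 3 / p ^ 2 * T ^ 3 + 2 * c * (l ^ 2 / p) * T ^ 2)| ≤ C)
    (hm : ∀ᶠ T : ℝ in atTop, |m T - (l * T ^ 3 - 2 * c * l * T ^ 2 - d * T)| ≤ C) (z : ℂ) :
    Tendsto (fun T => scaledIntegrand p l (n T) (m T) T z) atTop
      (nhds (Complex.exp (-z ^ 3 / 3 - c * z ^ 2 + d * z))) := by
  obtain ⟨E, hE, hlog⟩ := Complex.exists_log_one_add_eq
  obtain ⟨D, hD, hexp⟩ := Complex.exists_exp_eq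
  have hpC : (p : ℂ) ≠ 0 := by exact_mod_cast hp.ne'
  have hlC : (l : ℂ) ≠ 0 := by exact_mod_cast hl.ne'
  have hplC : (p : ℂ) = 1 - l := by
    rw [eq_sub_iff_add_eq]
    exact_mod_cast hpl
  set ζ : ℝ → ℂ := fun T => z / T with hζ
  have hζ0 : Tendsto ζ atTop (nhds 0) := by
    have := (Complex.continuous_ofReal.tendsto 0).comp tendsto_inv_atTop_zero
    simpa [hζ, div_eq_mul_inv, Function.comp_def] using this.const_mul z
  set Q : ℝ → ℂ := fun T => 1 + ζ T / 2 + ζ T ^ 2 * D (ζ T) with hQ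
  have hDζ := hD.comp hζ0
  have hQ1 : Tendsto Q atTop (nhds 1) := by
    have := ((hζ0.div_const 2).const_add 1).add ((hζ0.pow 2).mul hDζ)
    simpa [hQ] using this
  have hexpQ : ∀ T, Complex.exp (ζ T) - 1 = ζ T * Q T := by
    intro T
    rw [hexp, hQ]
    ring
  set y : ℝ → ℂ := fun T => -(p / l) * (ζ T * Q T) with hy
  have hy0 : Tendsto y atTop (nhds 0) := by
    simpa [hy] using (hζ0.mul hQ1).const_mul (-(p / l) : ℂ)
  have hEy := hE.comp hy0
  set L : ℝ → ℂ := fun T => Complex.log (1 + y T) with hL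
  have hL0 : Tendsto L atTop (nhds 0) := by
    have : Tendsto (fun T => y T - y T ^ 2 / 2 + y T ^ 3 * E (y T)) atTop (nhds 0) := by
      simpa using (hy0.sub ((hy0.pow 2).div_const 2)).add ((hy0.pow 3).mul hEy)
    exact this.congr fun T => (hlog _).symm
  set e₁ : ℝ → ℝ := fun T => n T - (l ^ 3 / p ^ 2 * T ^ 3 + 2 * c * (l ^ 2 / p) * T ^ 2) with he₁
  set e₂ : ℝ → ℝ := fun T => m T - (l * T ^ 3 - 2 * c * l * T ^ 2 - d * T) with he₂
  have h₁ : Tendsto (fun T => L T * (e₁ T : ℂ)) atTop (nhds 0) :=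
    hL0.zero_mul_isBoundedUnder_le
      (isBoundedUnder_of_eventually_le (a := C) (by simpa using hn))
  have h₂ : Tendsto (fun T => ζ T * (e₂ T : ℂ)) atTop (nhds 0) :=
    hζ0.zero_mul_isBoundedUnder_le
      (isBoundedUnder_of_eventually_le (a := C) (by simpa using hm))
  have hcubic : Tendsto (fun T => l * D (ζ T)
      - l / 2 * ((1 / 2 + ζ T * D (ζ T)) * (1 + Q T)) - p * E (y T) * Q T ^ 3) atTop
      (nhds (-1 / 3)) := by
    have := ((hDζ.const_mul (l : ℂ)).sub (((hζ0.mul hDζ).const_add (1 / 2)).mul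
      (hQ1.const_add 1) |>.const_mul (l / 2 : ℂ))).sub ((hEy.const_mul (p : ℂ)).mul (hQ1.pow 3))
    refine (this.trans_eq ?_)
    rw [hplC]
    congr 1
    ring
  have hquad : Tendsto (fun T => -l * (1 / 2 + ζ T * D (ζ T)) - p * Q T ^ 2 / 2
      - p ^ 2 / l * ζ T * Q T ^ 3 * E (y T)) atTop (nhds (-1 / 2)) := by
    have := ((((hζ0.mul hDζ).const_add (1 / 2)).const_mul (-l : ℂ)).sub
      (((hQ1.pow 2).const_mul (p : ℂ)).div_const 2)).sub
      (((hζ0.const_mul (p ^ 2 / l : ℂ)).mul (hQ1.pow 3)).mul hEy)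
    refine (this.trans_eq ?_)
    rw [hplC]
    congr 1
    ring
  have hphase := ((((hcubic.const_mul (z ^ 3)).add (hquad.const_mul (2 * c * z ^ 2))).add_const
    (d * z)).sub h₂).add h₁
  have hlim : Tendsto (fun T => Complex.exp (-m T * ζ T
      + (l / p * T ^ 3 : ℝ) * (Complex.exp (ζ T) - 1) + L T * n T)) atTop
      (nhds (Complex.exp (-z ^ 3 / 3 - c * z ^ 2 + d * z))) := by
    refine (Complex.continuous_exp.tendsto _).comp (Tendsto.congr' ?_ (hphase.trans_eq ?_))
    · filter_upwards [eventually_gt_atTop 0] with T hT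
      have hTC : (T : ℂ) ≠ 0 := by exact_mod_cast hT.ne'
      have hz : z = ζ T * T := by simp only [hζ]; field_simp
      have hLT : L T = y T - y T ^ 2 / 2 + y T ^ 3 * E (y T) := hlog _
      have hnT : (n T : ℂ) = e₁ T + (l ^ 3 / p ^ 2 * T ^ 3 + 2 * c * (l ^ 2 / p) * T ^ 2) := by
        simp only [he₁]; push_cast; ring
      have hmT : (m T : ℂ) = e₂ T + (l * T ^ 3 - 2 * c * l * T ^ 2 - d * T) := by
        simp only [he₂]; push_cast; ring
      rw [hexpQ, hnT, hmT, mul_add (L T), hLT, hz]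
      simp only [hy, hQ]
      generalize D (ζ T) = D'
      generalize ζ T = s at *
      generalize E _ = E'
      push_cast
      field_simp
      rw [hplC]
      ring
    · congr 1
      ring
  refine hlim.congr' ?_
  have hne : ∀ᶠ T in atTop, 1 + y T ≠ 0 := by
    have : Tendsto (fun T => 1 + y T) atTop (nhds 1) := by simpa using hy0.const_add 1
    exact this.eventually_ne one_ne_zero
  filter_upwards [hne] with T hT
  have hbase : (1 - p * Complex.exp (z / T)) / l = 1 + y T := by
    change (1 - p * Complex.exp (ζ T)) / l = 1 + -(p / l) * (ζ T * Q T)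
    rw [← hexpQ]
    field_simp
    rw [hplC]
    ring
  rw [scaledIntegrand, hbase, Complex.exp_add, mul_comm (L T), Complex.exp_int_mul, hL,
    Complex.exp_log hT]

theorem norm_one_sub_mul_exp_le {p ρ φ : ℝ} (hρ : p * ρ < 1) :
    ‖(1 : ℂ) - p * (ρ * Complex.exp (φ * Complex.I))‖
      ≤ (1 - p * ρ) * Real.exp (p * ρ * (1 - Real.cos φ) / (1 - p * ρ) ^ 2) := by
  have hpos : 0 < 1 - p * ρ := by linarith
  refine abs_le_of_sq_le_sq' ?_ (by positivity) |>.2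
  have hre : ‖(1 : ℂ) - p * (ρ * Complex.exp (φ * Complex.I))‖ ^ 2
      = (1 - p * ρ) ^ 2 + 2 * (p * ρ * (1 - Real.cos φ)) := by
    rw [Complex.sq_norm, Complex.normSq_apply, Complex.exp_mul_I, ← Complex.ofReal_cos,
      ← Complex.ofReal_sin]
    simp [-Complex.ofReal_cos, -Complex.ofReal_sin]
    linear_combination (p * ρ) ^ 2 * Real.sin_sq_add_cos_sq φ
  rw [hre, mul_pow, ← Real.exp_nat_mul]
  have := Real.add_one_le_exp ((2 : ℕ) * (p * ρ * (1 - Real.cos φ) / (1 - p * ρ) ^ 2))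
  calc (1 - p * ρ) ^ 2 + 2 * (p * ρ * (1 - Real.cos φ))
      = (1 - p * ρ) ^ 2 * ((2 : ℕ) * (p * ρ * (1 - Real.cos φ) / (1 - p * ρ) ^ 2) + 1) := by
        push_cast
        field_simp
        ring
    _ ≤ _ := by gcongr

theorem norm_scaledIntegrand_le {p l c κ T τ : ℝ} (hp : 0 < p) (hl : 0 < l) (hpl : p + l = 1)
    {n m : ℤ} (hn0 : 0 ≤ n) (hn : n ≤ l ^ 3 / p ^ 2 * T ^ 3 + 2 * c * (l ^ 2 / p) * T ^ 2)
    (hκ : 0 < κ) (hκc : 2 * c + 1 ≤ κ) (hT : 2 * κ ≤ T) (hτ : |τ| ≤ Real.pi * T) :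
    ‖scaledIntegrand p l n m T (-κ + τ * Complex.I)‖
      ≤ ‖scaledIntegrand p l n m T (-κ)‖ * Real.exp (-(l / Real.pi) ^ 2 * τ ^ 2) := by
  have hT0 : 0 < T := by linarith
  set ρ : ℝ := Real.exp (-(κ / T)) with hρ
  set φ : ℝ := τ / T with hφ
  have hx0 : 0 < κ / T := by positivity
  have hx1 : κ / T ≤ 1 / 2 := by
    rw [div_le_div_iff₀ hT0 (by norm_num)]
    linarith
  have hρ0 : 1 / 2 ≤ ρ := by
    have := Real.add_one_le_exp (-(κ / T))
    linarith
  have hρ1 : ρ ≤ 1 - κ / T / 2 := by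
    have h1 : Real.exp (κ / T) * ρ = 1 := by rw [hρ, ← Real.exp_add]; simp
    have h2 := Real.add_one_le_exp (κ / T)
    nlinarith
  have hpρ : 0 < p * ρ := by positivity
  have hpρ1 : p * ρ < 1 := by nlinarith
  have hw : ∀ σ : ℝ, Complex.exp ((-κ + σ * Complex.I) / T)
      = ρ * Complex.exp ((σ / T : ℝ) * Complex.I) := by
    intro σ
    rw [hρ, Complex.ofReal_exp, ← Complex.exp_add]
    congr 1
    push_cast
    ring
  have hnorm : ∀ σ : ℝ, ‖scaledIntegrand p l n m T (-κ + σ * Complex.I)‖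
      = Real.exp (m * (κ / T) + l / p * T ^ 3 * (ρ * Real.cos (σ / T) - 1))
        * (‖(1 : ℂ) - p * (ρ * Complex.exp ((σ / T : ℝ) * Complex.I))‖ / l) ^ n := by
    intro σ
    rw [scaledIntegrand, hw, norm_mul, norm_zpow, norm_div, Complex.norm_exp, Complex.norm_real,
      Real.norm_of_nonneg hl.le]
    congr 2
    have hs : ((-κ + σ * Complex.I) / T : ℂ) = ((-(κ / T) : ℝ) : ℂ) + (σ / T : ℝ) * Complex.I := by
      push_cast
      ring
    rw [hs, Complex.exp_mul_I, ← Complex.ofReal_cos, ← Complex.ofReal_sin, Complex.add_re,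
      Complex.re_ofReal_mul]
    congr 1
    · simp
    · simp [-Complex.ofReal_cos, -Complex.ofReal_sin, -Complex.ofReal_div]
  have h0 := hnorm 0
  simp only [Complex.ofReal_zero, zero_mul, add_zero, zero_div, Real.cos_zero, mul_one,
    Complex.exp_zero] at h0
  have h1pρ : ‖(1 : ℂ) - p * ρ‖ = 1 - p * ρ := by
    have : (1 : ℂ) - p * ρ = ((1 - p * ρ : ℝ) : ℂ) := by push_cast; ring
    rw [this, Complex.norm_real, Real.norm_of_nonneg (by linarith)]
  rw [hnorm, h0, h1pρ]
  set δ : ℝ := 1 - Real.cos φ with hδ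
  have hδφ : 2 / Real.pi ^ 2 * φ ^ 2 ≤ δ := by
    have : |φ| ≤ Real.pi := by
      rw [hφ, abs_div, abs_of_pos hT0, div_le_iff₀ hT0]
      exact hτ
    linarith [Real.cos_le_one_sub_mul_cos_sq this]
  lift n to ℕ using hn0
  simp only [zpow_natCast, Int.cast_natCast] at hn ⊢
  have hb := norm_one_sub_mul_exp_le (φ := φ) hpρ1
  have hpow : (‖(1 : ℂ) - p * (ρ * Complex.exp (φ * Complex.I))‖ / l) ^ n
      ≤ ((1 - p * ρ) / l) ^ n * Real.exp (n * (p * ρ * δ / (1 - p * ρ) ^ 2)) := by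
    rw [Real.exp_nat_mul, ← mul_pow]
    gcongr
    rw [div_mul_eq_mul_div]
    gcongr
  set t : ℝ := l / p ^ 2 * T ^ 3 with ht
  have hgap : l ^ 2 / p * T ^ 2 ≤ t * (1 - p * ρ) ^ 2 - n := by
    have h1 : l ^ 2 + 2 * l * p * (κ / T / 2) ≤ (1 - p * ρ) ^ 2 := by
      have : 1 - p * ρ = l + p * (1 - ρ) := by linear_combination -hpl
      rw [this]
      have h2 : 2 * l * p * (κ / T / 2) ≤ 2 * l * p * (1 - ρ) := by
        gcongr
        linarith
      nlinarith [sq_nonneg (p * (1 - ρ))]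
    have h3 : t * (l ^ 2 + 2 * l * p * (κ / T / 2)) ≤ t * (1 - p * ρ) ^ 2 := by gcongr
    have h4 : t * (l ^ 2 + 2 * l * p * (κ / T / 2))
        = l ^ 3 / p ^ 2 * T ^ 3 + κ * (l ^ 2 / p * T ^ 2) := by
      rw [ht]
      field_simp
    have h5 : (2 * c + 1) * (l ^ 2 / p * T ^ 2) ≤ κ * (l ^ 2 / p * T ^ 2) := by gcongr
    linarith
  have hgap' : l ^ 2 / p * T ^ 2 ≤ t - n / (1 - p * ρ) ^ 2 := by
    have h1 : 0 < (1 - p * ρ) ^ 2 := by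
      have : 0 < 1 - p * ρ := by linarith
      positivity
    have h2 : (1 - p * ρ) ^ 2 ≤ 1 := by nlinarith
    have h3 : t - n / (1 - p * ρ) ^ 2 = (t * (1 - p * ρ) ^ 2 - n) / (1 - p * ρ) ^ 2 := by
      rw [sub_div, mul_div_cancel_right₀ _ h1.ne']
    rw [h3, le_div_iff₀ h1]
    refine le_trans ?_ hgap
    exact mul_le_of_le_one_right (by positivity) h2
  have hexponent : (l / Real.pi) ^ 2 * τ ^ 2 ≤ p * ρ * δ * (t - n / (1 - p * ρ) ^ 2) := by
    calc (l / Real.pi) ^ 2 * τ ^ 2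
        = p * (1 / 2) * (2 / Real.pi ^ 2 * φ ^ 2) * (l ^ 2 / p * T ^ 2) := by
          rw [hφ]
          field_simp
      _ ≤ _ := by
          have : 0 ≤ δ := le_trans (by positivity) hδφ
          gcongr
  calc _ ≤ Real.exp (m * (κ / T) + l / p * T ^ 3 * (ρ * Real.cos φ - 1))
        * (((1 - p * ρ) / l) ^ n * Real.exp (n * (p * ρ * δ / (1 - p * ρ) ^ 2))) := by
        gcongr
    _ = Real.exp (m * (κ / T) + l / p * T ^ 3 * (ρ - 1)) * ((1 - p * ρ) / l) ^ n
        * Real.exp (-(p * ρ * δ * (t - n / (1 - p * ρ) ^ 2))) := by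
        have : m * (κ / T) + l / p * T ^ 3 * (ρ * Real.cos φ - 1)
            = (m * (κ / T) + l / p * T ^ 3 * (ρ - 1)) + (-(p * ρ * δ * t)) := by
          rw [hδ, ht]
          field_simp
          ring
        have hsplit : -(p * ρ * δ * (t - n / (1 - p * ρ) ^ 2))
            = -(p * ρ * δ * t) + n * (p * ρ * δ / (1 - p * ρ) ^ 2) := by ring
        rw [this, hsplit, Real.exp_add _ (-(p * ρ * δ * t)), Real.exp_add (-(p * ρ * δ * t))]
        ring
    _ ≤ _ := by
        have : 0 ≤ (1 - p * ρ) / l := div_nonneg (by linarith) hl.le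
        gcongr
        linarith

theorem norm_exp_airyPhase (α x y : ℝ) :
    ‖Complex.exp (-(x + y * Complex.I) ^ 3 / 3 + α * (x + y * Complex.I))‖
      = Real.exp (-x ^ 3 / 3 + α * x + x * y ^ 2) := by
  rw [Complex.norm_exp]
  congr 1
  have : (-(x + y * Complex.I) ^ 3 / 3 + α * (x + y * Complex.I) : ℂ)
      = ((-x ^ 3 / 3 + α * x + x * y ^ 2 : ℝ) : ℂ)
        + ((-x ^ 2 * y + y ^ 3 / 3 + α * y : ℝ) : ℂ) * Complex.I := by
    push_cast
    linear_combination (-x * y ^ 2 - y ^ 3 / 3 * Complex.I) * Complex.I_sq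
  rw [this]
  simp [-Complex.ofReal_add, -Complex.ofReal_mul, -Complex.ofReal_pow, -Complex.ofReal_div,
    -Complex.ofReal_neg]

theorem integrable_exp_airyPhase (α : ℝ) {k : ℝ} (hk : 0 < k) :
    MeasureTheory.Integrable (fun y : ℝ =>
      Complex.exp (-((-k : ℝ) + y * Complex.I) ^ 3 / 3 + α * ((-k : ℝ) + y * Complex.I))) := by
  refine ((integrable_exp_neg_mul_sq hk).const_mul
    (Real.exp (k ^ 3 / 3 - α * k))).mono' (by fun_prop) (Eventually.of_forall fun y => ?_)
  rw [norm_exp_airyPhase, ← Real.exp_add]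
  apply le_of_eq
  congr 1
  ring

theorem tendsto_integral_exp_airyPhase_edge (α : ℝ) {k : ℝ} (hk : 0 < k) {h : ℝ → ℝ}
    (hh : Tendsto (fun R => h R ^ 2) atTop atTop) :
    Tendsto (fun R => ∫ x in (-k)..0,
      Complex.exp (-(x + h R * Complex.I) ^ 3 / 3 + α * (x + h R * Complex.I)))
      atTop (nhds 0) := by
  have key := intervalIntegral.tendsto_integral_filter_of_dominated_convergence
    (μ := MeasureTheory.volume) (a := -k) (b := 0) (l := atTop)
    (F := fun R x : ℝ =>
      Complex.exp (-(x + h R * Complex.I) ^ 3 / 3 + α * (x + h R * Complex.I)))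
    (f := fun _ => 0) (fun x => Real.exp (-x ^ 3 / 3 + α * x))
    (Eventually.of_forall fun R => (by fun_prop))
    (Eventually.of_forall fun R => Eventually.of_forall fun x hx => ?_)
    (Continuous.intervalIntegrable (by fun_prop) _ _) ?_
  · simpa using key
  · rw [Set.uIoc_of_le (by linarith)] at hx
    rw [norm_exp_airyPhase]
    refine Real.exp_le_exp.2 ?_
    nlinarith [sq_nonneg (h R), hx.2]
  · have hne : ∀ᵐ x : ℝ, x ≠ 0 := by simp [MeasureTheory.ae_iff, MeasureTheory.measure_singleton]
    filter_upwards [hne] with x hx0 hx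
    rw [Set.uIoc_of_le (by linarith)] at hx
    rw [tendsto_zero_iff_norm_tendsto_zero]
    simp_rw [norm_exp_airyPhase]
    refine Real.tendsto_exp_atBot.comp (tendsto_atBot_add_const_left _ _ ?_)
    exact hh.const_mul_atTop_of_neg (lt_of_le_of_ne hx.2 hx0)

theorem integral_exp_airyPhase_imaginary (α R : ℝ) :
    ∫ y in (-R)..R, Complex.exp (-(y * Complex.I) ^ 3 / 3 + α * (y * Complex.I))
      = 2 * ((∫ s in (0:ℝ)..R, Real.cos (s ^ 3 / 3 + α * s) : ℝ) : ℂ) := by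
  set f : ℝ → ℂ := fun y => Complex.exp (-(y * Complex.I) ^ 3 / 3 + α * (y * Complex.I)) with hf
  have hc : Continuous f := by fun_prop
  have hint : ∀ a b, IntervalIntegrable f MeasureTheory.volume a b :=
    fun a b => hc.intervalIntegrable a b
  have hneg : ∫ y in (-R)..0, f y = ∫ y in (0:ℝ)..R, f (-y) := by
    rw [intervalIntegral.integral_comp_neg]
    simp
  rw [← intervalIntegral.integral_add_adjacent_intervals (hint (-R) 0) (hint 0 R), hneg,
    ← intervalIntegral.integral_add (f := fun y => f (-y))
      ((hc.comp continuous_neg).intervalIntegrable _ _) (hint 0 R),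
    ← intervalIntegral.integral_ofReal, ← intervalIntegral.integral_const_mul]
  congr 1
  ext y
  have h1 : ∀ y : ℝ, f y = Complex.exp ((y ^ 3 / 3 + α * y : ℝ) * Complex.I) := by
    intro y
    simp only [hf]
    congr 1
    push_cast
    linear_combination (-(y : ℂ) ^ 3 / 3 * Complex.I) * Complex.I_sq
  have h2 : (-y) ^ 3 / 3 + α * -y = -(y ^ 3 / 3 + α * y) := by ring
  rw [h1, h1, h2, Complex.ofReal_neg, Complex.ofReal_cos, Complex.two_cos, add_comm]

theorem integral_exp_airyPhase_eq_Ai (α : ℝ) {k : ℝ} (hk : 0 < k) :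
    ∫ y : ℝ, Complex.exp (-((-k : ℝ) + y * Complex.I) ^ 3 / 3 + α * ((-k : ℝ) + y * Complex.I))
      = 2 * Real.pi * Ai α := by
  set J := ∫ y : ℝ,
    Complex.exp (-((-k : ℝ) + y * Complex.I) ^ 3 / 3 + α * ((-k : ℝ) + y * Complex.I)) with hJ
  set f : ℂ → ℂ := fun s => Complex.exp (-s ^ 3 / 3 + α * s) with hf
  set c : ℝ → ℝ := fun R => ∫ s in (0:ℝ)..R, Real.cos (s ^ 3 / 3 + α * s) with hc
  have hJlim : Tendsto (fun R : ℝ => ∫ y in (-R)..R, f ((-k : ℝ) + y * Complex.I)) atTop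
      (nhds J) :=
    MeasureTheory.intervalIntegral_tendsto_integral (integrable_exp_airyPhase α hk)
      tendsto_neg_atTop_atBot tendsto_id
  have hbot := tendsto_integral_exp_airyPhase_edge α hk (h := fun R => -R)
    (by simp)
  have htop := tendsto_integral_exp_airyPhase_edge α hk (h := fun R => R)
    (tendsto_pow_atTop two_ne_zero)
  have hrect : ∀ R : ℝ, (∫ x : ℝ in (-k)..0, f (x + (-R : ℝ) * Complex.I))
      - (∫ x : ℝ in (-k)..0, f (x + R * Complex.I))
      + Complex.I * (2 * (c R : ℂ))
      - Complex.I * ∫ y in (-R)..R, f ((-k : ℝ) + y * Complex.I) = 0 := by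
    intro R
    have h := Complex.integral_boundary_rect_eq_zero_of_differentiableOn f
      ⟨-k, -R⟩ ⟨0, R⟩ (by fun_prop)
    simp only [smul_eq_mul, Complex.ofReal_zero, zero_add] at h
    rw [← integral_exp_airyPhase_imaginary]
    exact h
  have hclim : Tendsto (fun R => (c R : ℂ)) atTop (nhds (J / 2)) := by
    have h := (hJlim.add ((hbot.sub htop).const_mul Complex.I)).div_const 2
    simp only [sub_zero, mul_zero, add_zero] at h
    refine h.congr fun R => ?_
    have := hrect R
    simp only [hf] at this ⊢
    linear_combination (Complex.I / 2) * this
      - ((c R : ℂ) - (∫ y in (-R)..R, f ((-k : ℝ) + y * Complex.I)) / 2) * Complex.I_sq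
  have hre : Tendsto c atTop (nhds (J / 2).re) := by
    simpa [Function.comp_def] using (Complex.continuous_re.tendsto _).comp hclim
  have hJre : J / 2 = ((J / 2).re : ℂ) :=
    tendsto_nhds_unique hclim ((Complex.continuous_ofReal.tendsto _).comp hre)
  have hAi : Ai α = 1 / Real.pi * (J / 2).re := by rw [Ai, hre.limUnder_eq]
  have hpi : (Real.pi : ℂ) ≠ 0 := by exact_mod_cast Real.pi_ne_zero
  rw [hAi, Complex.ofReal_mul, ← hJre]
  push_cast
  field_simp

theorem circleIntegral_eq_of_differentiableOn_punctured {f : ℂ → ℂ}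
    (hf : DifferentiableOn ℂ f {0}ᶜ) {r R : ℝ} (hr : 0 < r) (hR : 0 < R) :
    ∮ w in C(0, r), f w = ∮ w in C(0, R), f w := by
  wlog h : R ≤ r generalizing r R
  · exact (this hR hr (le_of_not_ge h)).symm
  refine Complex.circleIntegral_eq_of_differentiable_on_annulus_off_countable hR h
    Set.countable_empty (hf.continuousOn.mono ?_) ?_
  · rintro w ⟨-, hw⟩ rfl
    exact hw (Metric.mem_ball_self hR)
  · rintro w ⟨⟨-, hw⟩, -⟩
    refine hf.differentiableAt (isOpen_compl_singleton.mem_nhds ?_)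
    rintro rfl
    exact hw (Metric.mem_closedBall_self hR.le)

theorem circleIntegral_eq_integral_scaledIntegrand {p l r T : ℝ} (κ : ℝ) (hp : 0 < p)
    (hl : 0 < l) (hpl : p + l = 1) (hr : 0 < r) (hT : 0 < T) {n m : ℤ} (hn : 0 ≤ n) :
    (T : ℂ) * ((p : ℂ) ^ m * (l : ℂ) ^ (-n) * ((2 * (Real.pi : ℂ) * Complex.I)⁻¹
        * ∮ w in C(0, r), (1 - w) ^ n
            * Complex.exp ((l / p ^ 2 * T ^ 3 : ℝ) * (w - 1 + l)) * w ^ (-(m + 1))))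
      = (2 * Real.pi : ℂ)⁻¹ * ∫ τ in (-(Real.pi * T))..(Real.pi * T),
          scaledIntegrand p l n m T (-κ + τ * Complex.I) := by
  have hpC : (p : ℂ) ≠ 0 := by exact_mod_cast hp.ne'
  have hlC : (l : ℂ) ≠ 0 := by exact_mod_cast hl.ne'
  have hTC : (T : ℂ) ≠ 0 := by exact_mod_cast hT.ne'
  have hplC : (l : ℂ) = 1 - p := by
    rw [eq_sub_iff_add_eq']
    exact_mod_cast hpl
  set f : ℂ → ℂ := fun w => (1 - w) ^ n
    * Complex.exp ((l / p ^ 2 * T ^ 3 : ℝ) * (w - 1 + l)) * w ^ (-(m + 1)) with hf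
  have hfd : DifferentiableOn ℂ f {0}ᶜ := by
    refine DifferentiableOn.mul (DifferentiableOn.mul ?_ (by fun_prop)) ?_
    · exact DifferentiableOn.zpow (by fun_prop) (Or.inr hn)
    · exact differentiableOn_zpow _ _ (Or.inl (by simp))
  set ρ : ℝ := p * Real.exp (-(κ / T)) with hρ
  set g : ℝ → ℂ := fun τ => scaledIntegrand p l n m T (-κ + τ * Complex.I) with hg
  have hpoint : ∀ θ : ℝ, (p : ℂ) ^ m * (l : ℂ) ^ (-n)
      * (circleMap 0 ρ θ * f (circleMap 0 ρ θ)) = g (T * θ) := by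
    intro θ
    set ζ : ℂ := (-κ + (T * θ : ℝ) * Complex.I) / T with hζ
    have hw : circleMap 0 ρ θ = p * Complex.exp ζ := by
      rw [circleMap_zero, hρ, Complex.ofReal_mul, Complex.ofReal_exp, mul_assoc, ← Complex.exp_add]
      congr 2
      rw [hζ]
      push_cast
      field_simp
    have hw0 : (p * Complex.exp ζ : ℂ) ≠ 0 := mul_ne_zero hpC (Complex.exp_ne_zero _)
    have hpow : (p * Complex.exp ζ : ℂ) * (p * Complex.exp ζ) ^ (-(m + 1))
        = (p : ℂ) ^ (-m) * Complex.exp (-m * ζ) := by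
      rw [neg_add, zpow_add₀ hw0, mul_zpow, zpow_neg_one, mul_comm, mul_assoc,
        inv_mul_cancel₀ hw0, mul_one, ← Complex.exp_int_mul]
      push_cast
      rfl
    have hphase : ((l / p ^ 2 * T ^ 3 : ℝ) : ℂ) * (p * Complex.exp ζ - 1 + l)
        = (l / p * T ^ 3 : ℝ) * (Complex.exp ζ - 1) := by
      push_cast
      rw [hplC]
      field_simp
      ring
    simp only [hg, scaledIntegrand, hf, hw, ← hζ]
    rw [hphase, div_zpow, Complex.exp_add]
    calc _ = (p : ℂ) ^ m * (l : ℂ) ^ (-n) * ((1 - p * Complex.exp ζ) ^ n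
          * Complex.exp ((l / p * T ^ 3 : ℝ) * (Complex.exp ζ - 1))
          * ((p * Complex.exp ζ : ℂ) * (p * Complex.exp ζ) ^ (-(m + 1)))) := by ring
      _ = _ := by
        rw [hpow, zpow_neg, zpow_neg]
        have := zpow_ne_zero m hpC
        field_simp
  have hperiodic : Function.Periodic (fun θ => circleMap 0 ρ θ * f (circleMap 0 ρ θ))
      (2 * Real.pi) := fun θ => by
    change circleMap 0 ρ _ * f (circleMap 0 ρ _) = _
    rw [periodic_circleMap 0 ρ θ]
  have hcircle : ∮ w in C(0, r), f w
      = Complex.I * ∫ θ in (-Real.pi)..Real.pi, circleMap 0 ρ θ * f (circleMap 0 ρ θ) := by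
    rw [circleIntegral_eq_of_differentiableOn_punctured hfd hr (by positivity : 0 < ρ),
      circleIntegral, ← intervalIntegral.integral_const_mul]
    have h := (hperiodic.intervalIntegral_add_eq 0 (-Real.pi))
    rw [zero_add, show -Real.pi + 2 * Real.pi = Real.pi by ring] at h
    simp only [deriv_circleMap, smul_eq_mul]
    rw [intervalIntegral.integral_const_mul, ← h, ← intervalIntegral.integral_const_mul]
    congr 1
    ext θ
    ring
  have hscale : ∫ τ in (-(Real.pi * T))..(Real.pi * T), g τ
      = T * ∫ θ in (-Real.pi)..Real.pi, g (T * θ) := by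
    have := intervalIntegral.smul_integral_comp_mul_left (a := -Real.pi) (b := Real.pi) g T
    rw [Complex.real_smul] at this
    rw [this]
    congr 1 <;> ring
  rw [hcircle, hscale]
  simp only [← hpoint]
  rw [intervalIntegral.integral_const_mul]
  have hpi : (Real.pi : ℂ) ≠ 0 := by exact_mod_cast Real.pi_ne_zero
  field_simp

theorem tendsto_integral_scaledIntegrand {p l c d C κ : ℝ} (hp : 0 < p) (hl : 0 < l)
    (hpl : p + l = 1) {n m : ℝ → ℤ} (hn0 : ∀ᶠ T in atTop, 0 ≤ n T)
    (hn : ∀ᶠ T : ℝ in atTop, |n T - (l ^ 3 / p ^ 2 * T ^ 3 + 2 * c * (l ^ 2 / p) * T ^ 2)| ≤ C)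
    (hn' : ∀ᶠ T : ℝ in atTop, n T ≤ l ^ 3 / p ^ 2 * T ^ 3 + 2 * c * (l ^ 2 / p) * T ^ 2)
    (hm : ∀ᶠ T : ℝ in atTop, |m T - (l * T ^ 3 - 2 * c * l * T ^ 2 - d * T)| ≤ C)
    (hκ : 0 < κ) (hκc : 2 * c + 1 ≤ κ) :
    Tendsto (fun T => ∫ τ in (-(Real.pi * T))..(Real.pi * T),
      scaledIntegrand p l (n T) (m T) T (-κ + τ * Complex.I)) atTop
      (nhds (∫ τ : ℝ, Complex.exp (-(-κ + τ * Complex.I) ^ 3 / 3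
        - c * (-κ + τ * Complex.I) ^ 2 + d * (-κ + τ * Complex.I)))) := by
  have hlim := tendsto_scaledIntegrand hp hl hpl hn hm
  have hB := (hlim (-κ)).norm.eventually_le_const (lt_add_one _)
  set B : ℝ := ‖Complex.exp (-(-κ) ^ 3 / 3 - c * (-κ) ^ 2 + d * (-κ))‖ + 1
  have key := MeasureTheory.tendsto_integral_filter_of_dominated_convergence
    (μ := MeasureTheory.volume) (l := atTop)
    (F := fun T : ℝ => (Set.Ioc (-(Real.pi * T)) (Real.pi * T)).indicator
      fun τ : ℝ => scaledIntegrand p l (n T) (m T) T (-κ + τ * Complex.I))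
    (f := fun τ : ℝ => Complex.exp (-(-κ + τ * Complex.I) ^ 3 / 3
        - c * (-κ + τ * Complex.I) ^ 2 + d * (-κ + τ * Complex.I)))
    (fun τ => B * Real.exp (-(l / Real.pi) ^ 2 * τ ^ 2)) ?_ ?_ ?_ ?_
  · refine key.congr' ?_
    filter_upwards [eventually_gt_atTop 0] with T hT
    have : 0 ≤ Real.pi * T := by positivity
    rw [MeasureTheory.integral_indicator measurableSet_Ioc,
      intervalIntegral.integral_of_le (by linarith)]
  · filter_upwards [hn0] with T hT
    refine (Continuous.aestronglyMeasurable ?_).indicator measurableSet_Ioc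
    unfold scaledIntegrand
    exact Continuous.mul (by fun_prop)
      (Continuous.zpow₀ (by fun_prop) _ fun _ => Or.inr hT)
  · filter_upwards [hn0, hn', hB, eventually_ge_atTop (2 * κ)] with T h0 h1 h2 h3
    refine Eventually.of_forall fun τ => ?_
    have hB0 : 0 ≤ B := by positivity
    by_cases hτ : τ ∈ Set.Ioc (-(Real.pi * T)) (Real.pi * T)
    · rw [Set.indicator_of_mem hτ]
      refine (norm_scaledIntegrand_le hp hl hpl h0 h1 hκ hκc h3
        (abs_le.2 ⟨hτ.1.le, hτ.2⟩)).trans ?_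
      gcongr
    · rw [Set.indicator_of_notMem hτ, norm_zero]
      positivity
  · exact (integrable_exp_neg_mul_sq (by positivity)).const_mul B
  · refine Eventually.of_forall fun τ => (hlim (-κ + τ * Complex.I)).congr' ?_
    filter_upwards [eventually_gt_atTop (|τ| / Real.pi)] with T hT
    rw [div_lt_iff₀ Real.pi_pos, mul_comm] at hT
    have hτ : τ ∈ Set.Ioc (-(Real.pi * T)) (Real.pi * T) :=
      ⟨(abs_lt.1 hT).1, (abs_lt.1 hT).2.le⟩
    rw [Set.indicator_of_mem hτ]

theorem integral_exp_cubic_eq_Ai {c d κ : ℝ} (hκ : c < κ) :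
    ∫ τ : ℝ, Complex.exp (-(-κ + τ * Complex.I) ^ 3 / 3
        - c * (-κ + τ * Complex.I) ^ 2 + d * (-κ + τ * Complex.I))
      = 2 * Real.pi * (Ai (c ^ 2 + d) * Real.exp (-2 * c ^ 3 / 3 - c * d) : ℝ) := by
  rw [Complex.ofReal_mul, ← mul_assoc, ← integral_exp_airyPhase_eq_Ai _ (sub_pos.2 hκ),
    ← MeasureTheory.integral_mul_const]
  congr 1
  ext τ
  rw [Complex.ofReal_exp, ← Complex.exp_add]
  congr 1
  push_cast
  ring

theorem eventually_nonneg_of_abs_sub_le {a b C : ℝ} (ha : 0 < a) {n : ℝ → ℤ}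
    (hn : ∀ᶠ T : ℝ in atTop, |n T - (a * T ^ 3 + b * T ^ 2)| ≤ C) :
    ∀ᶠ T in atTop, 0 ≤ n T := by
  have h : Tendsto (fun T : ℝ => T ^ 2 * (a * T + b)) atTop atTop :=
    (tendsto_pow_atTop two_ne_zero).atTop_mul_atTop₀
      (tendsto_atTop_add_const_right _ _ (tendsto_id.const_mul_atTop ha))
  filter_upwards [hn, h.eventually_ge_atTop C] with T h1 h2
  have h3 := (abs_le.1 h1).1
  have : (0 : ℝ) ≤ n T := by nlinarith
  exact_mod_cast this

theorem tendsto_circleIntegral_Ai {p l c d C r : ℝ} (hp : 0 < p) (hl : 0 < l)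
    (hpl : p + l = 1) (hr : 0 < r) {n m : ℝ → ℤ}
    (hn : ∀ᶠ T : ℝ in atTop, |n T - (l ^ 3 / p ^ 2 * T ^ 3 + 2 * c * (l ^ 2 / p) * T ^ 2)| ≤ C)
    (hn' : ∀ᶠ T : ℝ in atTop, n T ≤ l ^ 3 / p ^ 2 * T ^ 3 + 2 * c * (l ^ 2 / p) * T ^ 2)
    (hm : ∀ᶠ T : ℝ in atTop, |m T - (l * T ^ 3 - 2 * c * l * T ^ 2 - d * T)| ≤ C) :
    Tendsto (fun T : ℝ => (T : ℂ) * ((p : ℂ) ^ m T * (l : ℂ) ^ (-n T)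
        * ((2 * (Real.pi : ℂ) * Complex.I)⁻¹ * ∮ w in C(0, r), (1 - w) ^ n T
            * Complex.exp ((l / p ^ 2 * T ^ 3 : ℝ) * (w - 1 + l)) * w ^ (-(m T + 1)))))
      atTop (nhds (Ai (c ^ 2 + d) * Real.exp (-2 * c ^ 3 / 3 - c * d) : ℝ)) := by
  have hn0 := eventually_nonneg_of_abs_sub_le (by positivity) hn
  have hκ : 0 < 2 * |c| + 1 := by positivity
  have hκc : 2 * c + 1 ≤ 2 * |c| + 1 := by linarith [le_abs_self c]
  have h := (tendsto_integral_scaledIntegrand hp hl hpl hn0 hn hn' hm hκ hκc).const_mul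
    (2 * Real.pi : ℂ)⁻¹
  rw [integral_exp_cubic_eq_Ai (by linarith [le_abs_self c, abs_nonneg c]), ← mul_assoc,
    inv_mul_cancel₀ (by exact_mod_cast Real.two_pi_pos.ne'), one_mul] at h
  refine h.congr' ?_
  filter_upwards [hn0, eventually_gt_atTop 0] with T h0 hT
  exact (circleIntegral_eq_integral_scaledIntegrand _ hp hl hpl hr hT h0).symm

theorem Real.rpow_one_third_pow_three {x : ℝ} (hx : 0 ≤ x) : (x ^ ((1:ℝ)/3)) ^ 3 = x := by
  rw [← Real.rpow_natCast, ← Real.rpow_mul hx]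
  norm_num

theorem Real.rpow_two_thirds_eq {x : ℝ} (hx : 0 ≤ x) : x ^ ((2:ℝ)/3) = (x ^ ((1:ℝ)/3)) ^ 2 := by
  rw [← Real.rpow_natCast, ← Real.rpow_mul hx]
  norm_num

/-- Lemma A.3 of the paper. Steep descent limit of
`S_{−t,−n}(y,x)` around the critical point `1−λ`:
`lim_{t→∞} (2^{1/3} χ^{2/3} t^{1/3}/λ) S(t)
  = 2^{1/3} Ai(2^{4/3} ξ² + 2^{1/3}(u+v)) e^{−(8/3)ξ³ − 2ξ(u+v)}`. -/
theorem Skernel_limit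
    (lam : ℝ) (hlam0 : 0 < lam) (hlam1 : lam < 1)
    (ξ u v : ℝ) (r : ℝ) (hr0 : 0 < r) (hr1 : r < 1) :
    Tendsto
      (fun t : ℝ =>
        ((2 ^ ((1:ℝ)/3) * (lam * (1 - lam)) ^ ((2:ℝ)/3) * t ^ ((1:ℝ)/3) / lam : ℝ) : ℂ)
          * Skernel lam ξ u v r t)
      atTop
      (nhds (((2 ^ ((1:ℝ)/3)
          * Ai (2 ^ ((4:ℝ)/3) * ξ ^ 2 + 2 ^ ((1:ℝ)/3) * (u + v))
          * Real.exp (-(8/3) * ξ ^ 3 - 2 * ξ * (u + v)) : ℝ) : ℂ))) := by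
  obtain ⟨p, hp⟩ : ∃ p, p = 1 - lam := ⟨_, rfl⟩
  have hp0 : 0 < p := by linarith
  obtain ⟨s, hs⟩ : ∃ s : ℝ, s = 2 ^ ((1:ℝ)/3) := ⟨_, rfl⟩
  obtain ⟨a, ha⟩ : ∃ a : ℝ, a = (lam * (1 - lam)) ^ ((1:ℝ)/3) := ⟨_, rfl⟩
  have hs3 : s ^ 3 = 2 := by rw [hs, Real.rpow_one_third_pow_three (by norm_num)]
  have hlp : 0 < lam * (1 - lam) := by
    rw [← hp]
    positivity
  have ha3 : a ^ 3 = lam * p := by rw [ha, Real.rpow_one_third_pow_three hlp.le, hp]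
  have ha0 : 0 < a := ha ▸ Real.rpow_pos_of_pos hlp _
  have ha2 : (lam * (1 - lam)) ^ ((2:ℝ)/3) = a ^ 2 := by rw [Real.rpow_two_thirds_eq hlp.le, ha]
  have hs4 : (2:ℝ) ^ ((4:ℝ)/3) = s ^ 4 := by
    rw [hs, ← Real.rpow_natCast, ← Real.rpow_mul (by norm_num)]
    norm_num
  have hs5 : (2:ℝ) ^ ((5:ℝ)/3) = s ^ 5 := by
    rw [hs, ← Real.rpow_natCast, ← Real.rpow_mul (by norm_num)]
    norm_num
  set t : ℝ → ℝ := fun T => lam / p ^ 2 * T ^ 3 with ht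
  have hroot : ∀ T, 0 ≤ T → t T ^ ((1:ℝ)/3) = a * T / p := by
    intro T hT
    have : t T = (a * T / p) ^ 3 := by
      simp only [ht]
      rw [div_pow, mul_pow, ha3]
      field_simp
    rw [this, ← Real.rpow_natCast, ← Real.rpow_mul (by positivity)]
    norm_num
  have hroot2 : ∀ T, 0 ≤ T → t T ^ ((2:ℝ)/3) = (a * T / p) ^ 2 := by
    intro T hT
    rw [Real.rpow_two_thirds_eq (by positivity), hroot T hT]
  have hnarg : ∀ T, 0 ≤ T → nIdx lam ξ (t T)
      = ⌊lam ^ 3 / p ^ 2 * T ^ 3 + 2 * (s ^ 2 * ξ) * (lam ^ 2 / p) * T ^ 2⌋ := by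
    intro T hT
    rw [nIdx, hs5, ← ha, hroot2 T hT]
    congr 1
    simp only [ht]
    field_simp
    linear_combination (T ^ 2 * s ^ 2 * a ^ 3 * ξ) * hs3 + 2 * T ^ 2 * s ^ 2 * ξ * ha3
  have hxarg : ∀ T, 0 ≤ T → xIdx lam ξ u (t T)
      = ⌊(1 - 2 * lam) * (lam / p ^ 2) * T ^ 3 - 2 * (s ^ 2 * ξ) * (lam / p) * T ^ 2
          - s * u * T⌋ := by
    intro T hT
    rw [xIdx, hs5, ← ha, ha2, hroot2 T hT, hroot T hT, ← hs]
    congr 1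
    simp only [ht]
    field_simp
    linear_combination (-(s ^ 2 * a ^ 3 * ξ * T ^ 2 * lam)) * hs3
      - (2 * s ^ 2 * ξ * T ^ 2 * lam + s * u * p * T) * ha3
  have hyarg : ∀ T, 0 ≤ T → yIdx lam v (t T) = ⌊s * v * T⌋ := by
    intro T hT
    rw [yIdx, ha2, hroot T hT, ← hs]
    congr 1
    field_simp
    linear_combination (s * v * T) * ha3
  have hmain := tendsto_circleIntegral_Ai (c := s ^ 2 * ξ) (d := s * (u + v)) (C := 3) hp0 hlam0
    (by linarith) hr0 (n := fun T => nIdx lam ξ (t T))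
    (m := fun T => nIdx lam ξ (t T) + xIdx lam ξ u (t T) - yIdx lam v (t T)) ?_ ?_ ?_
  · have hT : Tendsto (fun x : ℝ => (p ^ 2 / lam * x) ^ ((1:ℝ)/3)) atTop atTop :=
      (tendsto_rpow_atTop (by norm_num)).comp (tendsto_id.const_mul_atTop (by positivity))
    have h := (hmain.comp hT).const_mul (s : ℂ)
    refine (h.congr' ?_).trans_eq ?_
    · filter_upwards [eventually_gt_atTop 0] with x hx
      set T : ℝ := (p ^ 2 / lam * x) ^ ((1:ℝ)/3) with hTdef
      have hT0 : 0 ≤ T := by positivity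
      have hx' : t T = x := by
        simp only [ht, hTdef]
        rw [Real.rpow_one_third_pow_three (by positivity)]
        field_simp
      have hpre : 2 ^ ((1:ℝ)/3) * (lam * (1 - lam)) ^ ((2:ℝ)/3) * x ^ ((1:ℝ)/3) / lam = s * T := by
        rw [ha2, ← hs, ← hx', hroot T hT0]
        field_simp
        linear_combination (s * T) * ha3
      have hpC : (1 : ℂ) - lam = p := by rw [hp]; push_cast; ring
      have hexp : ∀ i j k : ℤ, -(i + 1 + j - k) = -(i + j - k + 1) := fun i j k => by ring
      rw [hpre, Skernel, hpC, Complex.ofReal_mul, mul_assoc (s : ℂ), hexp]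
      have htT : lam / p ^ 2 * T ^ 3 = x := hx'
      simp only [Function.comp_apply, ← hTdef, hx', htT]
    · have hAi : (s ^ 2 * ξ) ^ 2 + s * (u + v) = s ^ 4 * ξ ^ 2 + s * (u + v) := by ring
      have hexp : -2 * (s ^ 2 * ξ) ^ 3 / 3 - s ^ 2 * ξ * (s * (u + v))
          = -(8 / 3) * ξ ^ 3 - 2 * ξ * (u + v) := by
        linear_combination (-(2 / 3) * (s ^ 3 + 2) * ξ ^ 3 - ξ * (u + v)) * hs3
      rw [← Complex.ofReal_mul, hs4, ← hs, hAi, hexp, ← mul_assoc]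
  · filter_upwards [eventually_ge_atTop 0] with T hT
    rw [hnarg T hT, abs_le]
    constructor <;> linarith [Int.floor_le (lam ^ 3 / p ^ 2 * T ^ 3
      + 2 * (s ^ 2 * ξ) * (lam ^ 2 / p) * T ^ 2), Int.lt_floor_add_one (lam ^ 3 / p ^ 2 * T ^ 3
      + 2 * (s ^ 2 * ξ) * (lam ^ 2 / p) * T ^ 2)]
  · filter_upwards [eventually_ge_atTop 0] with T hT
    rw [hnarg T hT]
    exact Int.floor_le _
  · filter_upwards [eventually_ge_atTop 0] with T hT
    rw [hnarg T hT, hxarg T hT, hyarg T hT]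
    set A := lam ^ 3 / p ^ 2 * T ^ 3 + 2 * (s ^ 2 * ξ) * (lam ^ 2 / p) * T ^ 2 with hA
    set X := (1 - 2 * lam) * (lam / p ^ 2) * T ^ 3 - 2 * (s ^ 2 * ξ) * (lam / p) * T ^ 2
      - s * u * T with hX
    have hsum : lam * T ^ 3 - 2 * (s ^ 2 * ξ) * lam * T ^ 2 - s * (u + v) * T
        = A + X - s * v * T := by
      have hl : lam = 1 - p := by linarith
      rw [hA, hX, hl]
      field_simp
      ring
    rw [hsum, abs_le]
    push_cast
    constructor <;> linarith [Int.floor_le A, Int.lt_floor_add_one A, Int.floor_le X,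
      Int.lt_floor_add_one X, Int.floor_le (s * v * T), Int.lt_floor_add_one (s * v * T)]
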